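/- Let P ⊆ ℝⁿ be a lattice n-polytope. If the topological interior of the dilate nP contains no point of ℤⁿ, then P is a basic simplex: there exist A ∈ GL(n, ℤ) and b ∈ ℤⁿ such that the affine map x ↦ A·x + b carries P onto Conv{0, e₁, …, eₙ}, the convex hull of the origin and the standard basis vectors. -/

import Mathlib

open Set Pointwise

noncomputable section

/-- The set of lattice points of `ℝⁿ`: points with all coordinates integers. -/
def lat (n : ℕ) : Set (Fin n → ℝ) := {x | ∀ i, ∃ z : ℤ, x i = (z : ℝ)}

/-- The dilate `kP` of a subset `P ⊆ ℝⁿ`. -/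
def dilate (n k : ℕ) (P : Set (Fin n → ℝ)) : Set (Fin n → ℝ) :=
  (fun x => (k : ℝ) • x) '' P

/-- A lattice `n`-polytope: the convex hull of finitely many lattice points,
whose affine hull is all of `ℝⁿ`. -/
def IsLatticePolytope (n : ℕ) (P : Set (Fin n → ℝ)) : Prop :=
  (∃ S : Finset (Fin n → ℤ), S.Nonempty ∧
    P = convexHull ℝ ((fun m : Fin n → ℤ => fun i => (m i : ℝ)) '' (S : Set (Fin n → ℤ)))) ∧
  affineSpan ℝ P = ⊤

/-- The cone of `P` at a point `v`: `C_v(P) = {r • (x - v) : r ≥ 0, x ∈ P}`. -/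
def coneAt (n : ℕ) (P : Set (Fin n → ℝ)) (v : Fin n → ℝ) : Set (Fin n → ℝ) :=
  {y | ∃ r : ℝ, 0 ≤ r ∧ ∃ x ∈ P, y = r • (x - v)}

/-- `P` is Gorenstein at `v`: there is a lattice point `m₀` in `C_v(P)` with
`Int(C_v(P)) ∩ ℤⁿ = m₀ + (C_v(P) ∩ ℤⁿ)`. -/
def GorensteinAt (n : ℕ) (P : Set (Fin n → ℝ)) (v : Fin n → ℝ) : Prop :=
  ∃ m₀ ∈ coneAt n P v ∩ lat n,
    interior (coneAt n P v) ∩ lat n = (fun y => m₀ + y) '' (coneAt n P v ∩ lat n)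

/-- `P` is Gorenstein: it is Gorenstein at every vertex (extreme point). -/
def Gorenstein (n : ℕ) (P : Set (Fin n → ℝ)) : Prop :=
  ∀ v ∈ Set.extremePoints ℝ P, GorensteinAt n P v

/-- `F` is a facet of the `n`-polytope `P`: a face (extreme subset) of dimension `n-1`. -/
def IsFacet (n : ℕ) (P F : Set (Fin n → ℝ)) : Prop :=
  IsExtreme ℝ P F ∧ Module.finrank ℝ (affineSpan ℝ F).direction = n - 1

/-- `P` is a pyramid: there are a facet `F` and a vertex `v ∉ F` with `P = Conv(F ∪ {v})`. -/
def IsPyramid (n : ℕ) (P : Set (Fin n → ℝ)) : Prop :=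
  ∃ F v, IsFacet n P F ∧ v ∈ Set.extremePoints ℝ P ∧ v ∉ F ∧
    P = convexHull ℝ (F ∪ {v})

/-- The simplex `D_n = Conv{0, e₁, e₂, e₁+e₂+2e₃, e₄, …, eₙ}` (standard basis `e₁, …, eₙ`,
so `eᵢ = Pi.single i⁻¹` with 0-based indices; the points `Pi.single i 1` for `(i : ℕ) ≠ 2`
are `e₁, e₂, e₄, …, eₙ`, and the last listed point is `e₁ + e₂ + 2e₃`). -/
def Dn (n : ℕ) : Set (Fin n → ℝ) :=
  convexHull ℝ ({0} ∪ {x | ∃ i : Fin n, (i : ℕ) ≠ 2 ∧ x = Pi.single i (1 : ℝ)} ∪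
    {fun j : Fin n => if (j : ℕ) = 0 ∨ (j : ℕ) = 1 then (1 : ℝ) else
      if (j : ℕ) = 2 then 2 else 0})

/-- The affine map `x ↦ A·x + b` of `ℝⁿ` given by an integral matrix `A` and `b ∈ ℤⁿ`. -/
def unimodularMap (n : ℕ) (A : Matrix (Fin n) (Fin n) ℤ) (b : Fin n → ℤ) :
    (Fin n → ℝ) → (Fin n → ℝ) :=
  fun x => (A.map (Int.cast : ℤ → ℝ)).mulVec x + fun i => (b i : ℝ)

/-- The basic simplex `Conv{0, e₁, …, eₙ}`. -/
def basicSimplex (n : ℕ) : Set (Fin n → ℝ) :=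
  convexHull ℝ ({0} ∪ Set.range fun i : Fin n => (Pi.single i (1 : ℝ) : Fin n → ℝ))

/-- A ray (one-dimensional face) of a cone `C`. -/
def IsRay (n : ℕ) (C ρ : Set (Fin n → ℝ)) : Prop :=
  IsExtreme ℝ C ρ ∧ Module.finrank ℝ (Submodule.span ℝ ρ) = 1


theorem mem_interior_dilate_of_pos {ι : Type*} [Fintype ι] {n k : ℕ}
    (b : AffineBasis ι ℝ (Fin n → ℝ)) {P : Set (Fin n → ℝ)} (hP : Convex ℝ P)
    (hb : range b ⊆ P) (hk : 0 < k) {c : ι → ℝ} (hc : ∀ i, 0 < c i) {d : ℝ} (hd : 0 ≤ d)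
    {w : Fin n → ℝ} (hw : w ∈ P) (hsum : ∑ i, c i + d = k) :
    ∑ i, c i • b i + d • w ∈ interior (dilate n k P) := by
  have hk' : (0 : ℝ) < k := by exact_mod_cast hk
  have : Nonempty ι := b.nonempty
  have hC : 0 < ∑ i, c i := Finset.sum_pos (fun i _ => hc i) Finset.univ_nonempty
  set C := ∑ i, c i
  have hq1 : ∑ i, c i / C = 1 := by rw [← Finset.sum_div]; exact div_self hC.ne'
  have hq : ∑ i, (c i / C) • b i ∈ interior P := by
    refine interior_mono (convexHull_min hb hP) ?_
    rw [AffineBasis.interior_convexHull]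
    intro i
    rw [← Finset.affineCombination_eq_linear_combination _ _ _ hq1,
      b.coord_apply_combination_of_mem (Finset.mem_univ i) hq1]
    exact div_pos (hc i) hC
  have hmem := hP.combo_interior_self_mem_interior hq hw (div_pos hC hk') (div_nonneg hd hk'.le)
    (by rw [← add_div, hsum, div_self hk'.ne'])
  have hdil : dilate n k P = (k : ℝ) • P := rfl
  rw [hdil, interior_smul₀ hk'.ne']
  refine ⟨_, hmem, ?_⟩
  simp only [smul_add, Finset.smul_sum, smul_smul]
  congr 1
  · refine Finset.sum_congr rfl fun i _ => ?_
    congr 1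
    field_simp
  · congr 1
    field_simp

theorem intCast_mem_lat {n : ℕ} (m : Fin n → ℤ) : (fun i => (m i : ℝ)) ∈ lat n :=
  fun i => ⟨m i, rfl⟩

theorem sum_smul_mem_lat {ι : Type*} [Fintype ι] {n : ℕ} (a : ι → ℤ) {x : ι → Fin n → ℝ}
    (hx : ∀ i, x i ∈ lat n) : ∑ i, (a i : ℝ) • x i ∈ lat n := by
  intro j
  choose z hz using hx
  refine ⟨∑ i, a i * z i j, ?_⟩
  simp [Finset.sum_apply, hz]

theorem add_mem_lat {n : ℕ} {x y : Fin n → ℝ} (hx : x ∈ lat n) (hy : y ∈ lat n) :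
    x + y ∈ lat n := by
  intro j
  obtain ⟨a, ha⟩ := hx j
  obtain ⟨c, hc⟩ := hy j
  exact ⟨a + c, by simp [ha, hc]⟩

theorem smul_mem_lat {n : ℕ} (a : ℤ) {x : Fin n → ℝ} (hx : x ∈ lat n) :
    (a : ℝ) • x ∈ lat n := by
  intro j
  obtain ⟨c, hc⟩ := hx j
  exact ⟨a * c, by simp [hc]⟩

/-- Barycentric coordinates of lattice points are integers: otherwise a translate by lattice
vectors into the half-open fundamental parallelepiped yields an interior lattice point. -/
theorem exists_int_coord_eq {ι : Type*} [Fintype ι] {n : ℕ} (hn : 0 < n)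
    (hι : Fintype.card ι = n + 1) (b : AffineBasis ι ℝ (Fin n → ℝ))
    (hlat : ∀ i, b i ∈ lat n) {P : Set (Fin n → ℝ)} (hP : Convex ℝ P) (hb : range b ⊆ P)
    (hempty : interior (dilate n n P) ∩ lat n = ∅) {x : Fin n → ℝ} (hx : x ∈ lat n) (i : ι) :
    ∃ z : ℤ, b.coord i x = z := by
  by_contra! hi
  set μ : ι → ℝ := fun k => b.coord k x - ⌈b.coord k x⌉ + 1 with hμ
  have hpos : ∀ k, 0 < μ k := fun k => by
    have := Int.ceil_lt_add_one (b.coord k x)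
    simp only [hμ]; linarith
  have hle : ∀ k, μ k ≤ 1 := fun k => by
    have := Int.le_ceil (b.coord k x)
    simp only [hμ]; linarith
  have hlt : μ i < 1 := by
    have := lt_of_le_of_ne (Int.le_ceil (b.coord i x)) (hi _)
    simp only [hμ]; linarith
  have hsum_lt : ∑ k, μ k < n + 1 := by
    calc ∑ k, μ k < ∑ _k : ι, (1 : ℝ) :=
          Finset.sum_lt_sum (fun k _ => hle k) ⟨i, Finset.mem_univ i, hlt⟩
      _ = n + 1 := by simp [hι]
  set K : ℤ := 1 - ∑ k, ⌈b.coord k x⌉ + (n + 1) with hKdef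
  have hK : ∑ k, μ k = K := by
    simp only [hμ, Finset.sum_add_distrib, Finset.sum_sub_distrib, b.sum_coord_apply_eq_one]
    simp [hKdef, hι]
  have hKn : K ≤ n := by
    rw [hK] at hsum_lt
    have : K < n + 1 := by exact_mod_cast hsum_lt
    omega
  have hKn' : (K : ℝ) ≤ n := by exact_mod_cast hKn
  have hint := mem_interior_dilate_of_pos b hP hb hn hpos (d := n - K) (by linarith)
    (hb (mem_range_self i)) (by rw [hK]; ring)
  refine Set.eq_empty_iff_forall_notMem.1 hempty _ ⟨hint, ?_⟩
  have hrw : ∑ k, μ k • b k = x + ∑ k, ((1 - ⌈b.coord k x⌉ : ℤ) : ℝ) • b k := by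
    conv_rhs => enter [1]; rw [← b.linear_combination_coord_eq_self x]
    rw [← Finset.sum_add_distrib]
    refine Finset.sum_congr rfl fun k _ => ?_
    rw [← add_smul]
    congr 1
    simp only [hμ]; push_cast; ring
  rw [hrw]
  refine add_mem_lat (add_mem_lat hx (sum_smul_mem_lat _ hlat)) ?_
  have := smul_mem_lat (n - K) (hlat i)
  push_cast at this
  exact this

/-- A point of `P` beyond a facet of the simplex spanned by `b` makes the sum of the vertices
of that facet interior to `nP`. -/
theorem coord_nonneg_of_mem {ι : Type*} [Fintype ι] {n : ℕ} (hn : 0 < n)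
    (hι : Fintype.card ι = n + 1) (b : AffineBasis ι ℝ (Fin n → ℝ))
    (hlat : ∀ i, b i ∈ lat n) {P : Set (Fin n → ℝ)} (hP : Convex ℝ P) (hb : range b ⊆ P)
    (hempty : interior (dilate n n P) ∩ lat n = ∅) {w : Fin n → ℝ} (hw : w ∈ P) (j : ι) :
    0 ≤ b.coord j w := by
  classical
  by_contra! hj
  set D : ℝ := 1 + ∑ i, |b.coord i w| with hD
  have habs : ∀ i, |b.coord i w| ≤ ∑ k, |b.coord k w| := fun i =>
    Finset.single_le_sum (f := fun k => |b.coord k w|) (fun k _ => abs_nonneg _)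
      (Finset.mem_univ i)
  have hDpos : 0 < D := by
    have := (abs_nonneg _).trans (habs j)
    linarith
  set e : ι → ℤ := fun i => if i = j then 0 else 1 with he
  set c : ι → ℝ := fun i => e i - D⁻¹ * b.coord i w with hc
  have hcpos : ∀ i, 0 < c i := fun i => by
    by_cases hij : i = j
    · subst hij
      have := mul_neg_of_pos_of_neg (inv_pos.2 hDpos) hj
      simp only [hc, he]; simpa using this
    · have h1 : b.coord i w < D := by
        have := (le_abs_self _).trans (habs i)
        linarith
      have h2 : D⁻¹ * b.coord i w < 1 := by
        rw [inv_mul_lt_iff₀ hDpos]; linarith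
      simp only [hc, he, if_neg hij]; push_cast; linarith
  have hesum : ∑ i, (e i : ℝ) = n := by
    have h : ∀ i, (e i : ℝ) = 1 - if i = j then 1 else 0 := fun i => by
      simp only [he]; split_ifs <;> simp
    simp [h, hι]
  have hint := mem_interior_dilate_of_pos b hP hb hn hcpos (inv_pos.2 hDpos).le hw (by
    simp only [hc, Finset.sum_sub_distrib, ← Finset.mul_sum, b.sum_coord_apply_eq_one, hesum]
    ring)
  refine Set.eq_empty_iff_forall_notMem.1 hempty _ ⟨hint, ?_⟩
  have hrw : ∑ i, c i • b i + D⁻¹ • w = ∑ i, (e i : ℝ) • b i := by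
    conv_lhs => enter [2, 2]; rw [← b.linear_combination_coord_eq_self w]
    rw [Finset.smul_sum, ← Finset.sum_add_distrib]
    refine Finset.sum_congr rfl fun i _ => ?_
    rw [smul_smul, ← add_smul]
    congr 1
    simp only [hc]; ring
  rw [hrw]
  exact sum_smul_mem_lat _ hlat

/-- An affine function with integer values on the lattice has integer coefficients. -/
theorem exists_int_coeffs {n : ℕ} (f : (Fin n → ℝ) →ᵃ[ℝ] ℝ)
    (hf : ∀ x ∈ lat n, ∃ z : ℤ, f x = z) :
    ∃ (a : Fin n → ℤ) (b : ℤ), ∀ x, f x = ∑ j, (a j : ℝ) * x j + b := by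
  obtain ⟨b, hb⟩ := hf 0 fun i => ⟨0, by simp⟩
  have hs : ∀ j : Fin n, ∃ z : ℤ, f (Pi.single j 1) = z := fun j => hf _ fun i => by
    by_cases h : i = j
    · subst h; exact ⟨1, by simp⟩
    · exact ⟨0, by simp [h]⟩
  choose z hz using hs
  have hdec : ∀ x, f x = f.linear x + b := fun x => by
    rw [← hb]; exact congrFun f.decomp x
  refine ⟨fun j => z j - b, b, fun x => ?_⟩
  rw [hdec, LinearMap.pi_apply_eq_sum_univ f.linear x]
  congr 1
  refine Finset.sum_congr rfl fun j _ => ?_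
  have h1 := hdec (Pi.single j 1)
  rw [hz] at h1
  have h2 : (fun i => if j = i then (1 : ℝ) else 0) = Pi.single j 1 := by
    ext i; simp [Pi.single_apply, eq_comm]
  push_cast
  rw [h2, h1, smul_eq_mul]
  ring

/-- A full-dimensional convex hull of lattice points contains an affine basis among its
generators. -/
theorem exists_affineBasis_range_subset {n : ℕ} {s : Set (Fin n → ℝ)}
    (hs : affineSpan ℝ s = ⊤) :
    ∃ b : AffineBasis (Fin (n + 1)) ℝ (Fin n → ℝ), range b ⊆ s := by
  obtain ⟨t, hts, b, hbt⟩ := AffineBasis.exists_affine_subbasis hs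
  have : Finite t := b.finite
  have : Fintype t := Fintype.ofFinite t
  have hcard : Fintype.card t = n + 1 := by
    simpa using b.card_eq_finrank_add_one
  refine ⟨b.reindex (Fintype.equivFinOfCardEq hcard), ?_⟩
  rintro _ ⟨i, rfl⟩
  rw [AffineBasis.reindex_apply, hbt]
  exact hts (Subtype.coe_prop _)

/-- A lattice `n`-polytope `P` such that `nP` has no interior lattice points is a basic
simplex. -/
theorem basic_of_no_interior_in_nP (n : ℕ) (P : Set (Fin n → ℝ))
    (hP : IsLatticePolytope n P)
    (hempty : interior (dilate n n P) ∩ lat n = ∅) :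
    ∃ A : Matrix (Fin n) (Fin n) ℤ, ∃ b : Fin n → ℤ,
      IsUnit A.det ∧ unimodularMap n A b '' P = basicSimplex n := by
  obtain ⟨⟨S, hS, rfl⟩, hspan⟩ := hP
  rcases Nat.eq_zero_or_pos n with rfl | hn
  · exfalso
    have hne : (dilate 0 0 (convexHull ℝ
        ((fun m : Fin 0 → ℤ => fun i => (m i : ℝ)) '' (S : Set (Fin 0 → ℤ))))).Nonempty :=
      (((Finset.coe_nonempty.2 hS).image _).convexHull).image _
    rw [Subsingleton.eq_univ_of_nonempty hne, interior_univ] at hempty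
    exact Set.eq_empty_iff_forall_notMem.1 hempty 0 ⟨mem_univ _, fun i => i.elim0⟩
  rw [affineSpan_convexHull] at hspan
  obtain ⟨p, hpS⟩ := exists_affineBasis_range_subset hspan
  set P := convexHull ℝ
    ((fun m : Fin n → ℤ => fun i => (m i : ℝ)) '' (S : Set (Fin n → ℤ)))
  have hconv : Convex ℝ P := convex_convexHull ℝ _
  have hpP : range p ⊆ P := hpS.trans (subset_convexHull ℝ _)
  have hlat : ∀ i, p i ∈ lat n := fun i => by
    obtain ⟨m, -, hm⟩ := hpS (mem_range_self i)
    rw [← hm]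
    exact intCast_mem_lat m
  have hPeq : P = convexHull ℝ (range p) := by
    refine (convexHull_min hpP hconv).antisymm' fun w hw => ?_
    rw [AffineBasis.convexHull_eq_nonneg_coord]
    exact coord_nonneg_of_mem hn (by simp) p hlat hconv hpP hempty hw
  choose A b hAb using fun i : Fin n => exists_int_coeffs (p.coord i.succ)
    fun x hx => exists_int_coord_eq hn (by simp) p hlat hconv hpP hempty hx i.succ
  have hmap : ∀ x i, unimodularMap n (Matrix.of A) b x i = p.coord i.succ x := fun x i => by
    rw [hAb]; rfl
  refine ⟨Matrix.of A, b, ?_, ?_⟩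
  · choose V hV using hlat
    refine Matrix.isUnit_det_of_right_inverse
      (B := Matrix.of fun j k => V k.succ j - V 0 j) ?_
    ext i k
    have h := congrArg₂ (· - ·) (hAb i (p k.succ)) (hAb i (p 0))
    simp only [add_sub_add_right_eq_sub, ← Finset.sum_sub_distrib, ← mul_sub, hV] at h
    rw [p.coord_apply, p.coord_apply_ne (Fin.succ_ne_zero i), sub_zero] at h
    rw [Matrix.mul_apply, Matrix.one_apply]
    have h' : (((if i = k then 1 else 0 : ℤ)) : ℝ)
        = ((∑ j, A i j * (V k.succ j - V 0 j) : ℤ) : ℝ) := by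
      push_cast
      rw [← h]
      simp
    exact (Int.cast_injective h').symm
  · set F : (Fin n → ℝ) →ᵃ[ℝ] (Fin n → ℝ) := AffineMap.pi fun i : Fin n => p.coord i.succ
    have hF : unimodularMap n (Matrix.of A) b = F := by
      ext x i
      exact hmap x i
    rw [hPeq, hF, AffineMap.image_convexHull, basicSimplex, ← range_comp]
    congr 1
    rw [← Fin.cons_self_tail (F ∘ p), Fin.range_cons, Set.insert_eq]
    congr 2
    · ext i
      exact p.coord_apply_ne (Fin.succ_ne_zero i)
    · ext k i
      simp [F, Fin.tail, p.coord_apply, Pi.single_apply]
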